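/- arXiv:1705.08584 — 3 statements merged into one kernel-verified Lean document; each statement's English description precedes it below -/
import Mathlib

section
/- Let μ be a Borel probability measure on a measurable space Z, let P be a Borel probability measure on ℝ^d, let f : ℝ^d → ℝ^m be measurable, and let h, h' : Z → ℝ^d be measurable maps with ∫ ‖f(h(z)) − f(h'(z))‖ dμ(z) < ∞. Then |M_f(P, h_*μ) − M_f(P, h'_*μ)| ≤ 4 ∫ ‖f(h(z)) − f(h'(z))‖ dμ(z). -/
open MeasureTheory Real

/-- Squared MMD with the Gaussian kernel composed with `f`. -/
noncomputable def sqMMD {d m : ℕ} (f : EuclideanSpace ℝ (Fin d) → EuclideanSpace ℝ (Fin m))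
    (P Q : Measure (EuclideanSpace ℝ (Fin d))) : ℝ :=
  (∫ x, ∫ x', Real.exp (-‖f x - f x'‖ ^ 2) ∂P ∂P)
    - 2 * (∫ x, ∫ y, Real.exp (-‖f x - f y‖ ^ 2) ∂Q ∂P)
    + (∫ y, ∫ y', Real.exp (-‖f y - f y'‖ ^ 2) ∂Q ∂Q)

theorem gauss_lip (a b : ℝ) : |Real.exp (-a ^ 2) - Real.exp (-b ^ 2)| ≤ |a - b| := by
  have hd : ∀ x : ℝ, HasDerivAt (fun x : ℝ => Real.exp (-x ^ 2)) (Real.exp (-x ^ 2) * (-(2 * x))) x := by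
    intro x
    have h1 : HasDerivAt (fun x : ℝ => -x ^ 2) (-(2 * x)) x := by
      have h0 := (hasDerivAt_pow 2 x).neg
      norm_num at h0
      exact h0
    exact h1.exp
  have hb : ∀ x : ℝ, ‖Real.exp (-x ^ 2) * (-(2 * x))‖ ≤ 1 := by
    intro x
    rw [norm_mul, Real.norm_eq_abs, Real.norm_eq_abs, abs_of_pos (Real.exp_pos _), Real.exp_neg,
      inv_mul_le_iff₀ (Real.exp_pos _)]
    have h2 := Real.add_one_le_exp (x ^ 2)
    have h3 : |-(2 * x)| ≤ x ^ 2 + 1 := by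
      rw [abs_le]
      constructor <;> nlinarith [sq_nonneg (x - 1), sq_nonneg (x + 1)]
    linarith
  have := Convex.norm_image_sub_le_of_norm_hasDerivWithin_le (s := Set.univ)
    (fun x _ => (hd x).hasDerivWithinAt) (fun x _ => hb x) convex_univ (Set.mem_univ b)
    (Set.mem_univ a)
  simpa [Real.norm_eq_abs] using this

theorem gauss_lip' {E : Type*} [NormedAddCommGroup E] (u v u' v' : E) :
    |Real.exp (-‖u - v‖ ^ 2) - Real.exp (-‖u' - v'‖ ^ 2)| ≤ ‖u - u'‖ + ‖v - v'‖ := by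
  refine (gauss_lip _ _).trans ((abs_norm_sub_norm_le _ _).trans ?_)
  have : u - v - (u' - v') = (u - u') - (v - v') := by abel
  rw [this]
  exact norm_sub_le _ _

theorem gauss_integrable {X : Type*} [MeasurableSpace X] (ν : Measure X) [IsProbabilityMeasure ν]
    {m : ℕ} (u v : X → EuclideanSpace ℝ (Fin m)) (hu : Measurable u) (hv : Measurable v) :
    Integrable (fun x => Real.exp (-‖u x - v x‖ ^ 2)) ν := by
  refine Integrable.of_bound (C := 1) ?_ ?_
  · exact (Real.measurable_exp.comp (((hu.sub hv).norm.pow_const 2).neg)).aestronglyMeasurable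
  · refine Filter.Eventually.of_forall fun x => ?_
    rw [Real.norm_eq_abs, abs_of_pos (Real.exp_pos _), Real.exp_le_one_iff]
    have := sq_nonneg ‖u x - v x‖
    linarith

theorem gauss_map {X Z : Type*} [MeasurableSpace X] [MeasurableSpace Z]
    (ν : Measure X) [IsProbabilityMeasure ν] (μ : Measure Z) [IsProbabilityMeasure μ]
    {d m : ℕ} (f : EuclideanSpace ℝ (Fin d) → EuclideanSpace ℝ (Fin m)) (hf : Measurable f)
    (g : X → EuclideanSpace ℝ (Fin d)) (h : Z → EuclideanSpace ℝ (Fin d))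
    (hg : Measurable g) (hh : Measurable h) :
    (∫ x, ∫ y, Real.exp (-‖f x - f y‖ ^ 2) ∂(μ.map h) ∂(ν.map g)) =
      ∫ p, Real.exp (-‖f (g p.1) - f (h p.2)‖ ^ 2) ∂(ν.prod μ) := by
  have := Measure.isProbabilityMeasure_map (μ := μ) hh.aemeasurable
  have := Measure.isProbabilityMeasure_map (μ := ν) hg.aemeasurable
  have hi := gauss_integrable ((ν.map g).prod (μ.map h)) (fun p => f p.1) (fun p => f p.2)
    (hf.comp measurable_fst) (hf.comp measurable_snd)
  rw [← integral_prod _ hi]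
  have hi' := hi.aestronglyMeasurable
  rw [Measure.map_prod_map _ _ hg hh] at hi' ⊢
  rw [integral_map (hg.prodMap hh).aemeasurable hi']
  rfl

theorem gauss_diff {X Z : Type*} [MeasurableSpace X] [MeasurableSpace Z]
    (ν : Measure X) [IsProbabilityMeasure ν] (μ : Measure Z) [IsProbabilityMeasure μ]
    {d m : ℕ} (f : EuclideanSpace ℝ (Fin d) → EuclideanSpace ℝ (Fin m)) (hf : Measurable f)
    (g g' : X → EuclideanSpace ℝ (Fin d)) (h h' : Z → EuclideanSpace ℝ (Fin d))
    (hg : Measurable g) (hh : Measurable h) (hg' : Measurable g') (hh' : Measurable h')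
    (hi : Integrable (fun z => ‖f (g z) - f (g' z)‖) ν)
    (hj : Integrable (fun z => ‖f (h z) - f (h' z)‖) μ) :
    |(∫ x, ∫ y, Real.exp (-‖f x - f y‖ ^ 2) ∂(μ.map h) ∂(ν.map g)) -
      (∫ x, ∫ y, Real.exp (-‖f x - f y‖ ^ 2) ∂(μ.map h') ∂(ν.map g'))| ≤
      (∫ z, ‖f (g z) - f (g' z)‖ ∂ν) + ∫ z, ‖f (h z) - f (h' z)‖ ∂μ := by
  rw [gauss_map ν μ f hf g h hg hh, gauss_map ν μ f hf g' h' hg' hh', ← integral_sub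
    (gauss_integrable (ν.prod μ) (fun p => f (g p.1)) (fun p => f (h p.2)) (hf.comp (hg.comp measurable_fst)) (hf.comp (hh.comp measurable_snd)))
    (gauss_integrable (ν.prod μ) (fun p => f (g' p.1)) (fun p => f (h' p.2)) (hf.comp (hg'.comp measurable_fst))
      (hf.comp (hh'.comp measurable_snd)))]
  have e1 := integral_fun_fst (μ := ν) (ν := μ) (fun z => ‖f (g z) - f (g' z)‖)
  have e2 := integral_fun_snd (μ := ν) (ν := μ) (fun z => ‖f (h z) - f (h' z)‖)
  simp only [probReal_univ, one_smul] at e1 e2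
  rw [← e1, ← e2, ← integral_add (hi.comp_fst μ) (hj.comp_snd ν), ← Real.norm_eq_abs]
  exact norm_integral_le_of_norm_le ((hi.comp_fst μ).add (hj.comp_snd ν))
    (Filter.Eventually.of_forall fun p => gauss_lip' _ _ _ _)

/-- For a Borel probability measure `μ` on `Z`, a Borel probability measure `P` on `ℝ^d`,
a measurable feature map `f` and measurable `h h' : Z → ℝ^d` with
`∫ ‖f (h z) - f (h' z)‖ dμ < ∞`, we have
`|M_f(P, h_*μ) - M_f(P, h'_*μ)| ≤ 4 ∫ ‖f (h z) - f (h' z)‖ dμ(z)`. -/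
theorem abs_sqMMD_sub_sqMMD_map_le {Z : Type*} [MeasurableSpace Z]
    (μ : Measure Z) [IsProbabilityMeasure μ]
    {d m : ℕ} (P : Measure (EuclideanSpace ℝ (Fin d))) [IsProbabilityMeasure P]
    (f : EuclideanSpace ℝ (Fin d) → EuclideanSpace ℝ (Fin m)) (hf : Measurable f)
    (h h' : Z → EuclideanSpace ℝ (Fin d)) (hh : Measurable h) (hh' : Measurable h')
    (hint : Integrable (fun z => ‖f (h z) - f (h' z)‖) μ) :
    |sqMMD f P (μ.map h) - sqMMD f P (μ.map h')| ≤ 4 * ∫ z, ‖f (h z) - f (h' z)‖ ∂μ := by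
  have h1 := gauss_diff P μ f hf id id h h' measurable_id hh measurable_id hh' (by simp) hint
  have h2 := gauss_diff μ μ f hf h h' h h' hh hh hh' hh' hint hint
  simp only [Measure.map_id, id, sub_self, norm_zero, integral_zero, zero_add] at h1
  unfold sqMMD
  rw [abs_le] at *
  constructor <;> linarith [h1.1, h1.2, h2.1, h2.2]
end

section
/- Let P and Q be Borel probability measures on ℝ^m. If ∫∫ exp(−‖x − x'‖²) dP(x)dP(x') − 2∫∫ exp(−‖x − y‖²) dP(x)dQ(y) + ∫∫ exp(−‖y − y'‖²) dQ(y)dQ(y') = 0, then P = Q. -/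
open MeasureTheory Real

lemma gk_integrable {m : ℕ} :
    Integrable (fun v : EuclideanSpace ℝ (Fin m) => Complex.exp (-(1/4 : ℂ) * ‖v‖ ^ 2)) := by
  have := GaussianFourier.integrable_cexp_neg_mul_sq_norm_add (V := EuclideanSpace ℝ (Fin m))
    (b := 1/4) (by norm_num) 0 0
  simpa using this

lemma ker_integrable {m : ℕ} (M : Measure (EuclideanSpace ℝ (Fin m) × EuclideanSpace ℝ (Fin m)))
    [IsProbabilityMeasure M] :
    Integrable (fun p : EuclideanSpace ℝ (Fin m) × EuclideanSpace ℝ (Fin m) =>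
      Real.exp (-‖p.1 - p.2‖ ^ 2)) M := by
  refine Integrable.of_bound (C := 1) (Continuous.aestronglyMeasurable (by fun_prop)) ?_
  filter_upwards with p
  rw [Real.norm_eq_abs, abs_of_pos (Real.exp_pos _), Real.exp_le_one_iff]
  have := sq_nonneg ‖p.1 - p.2‖
  linarith

lemma key {m : ℕ} (μ ν : Measure (EuclideanSpace ℝ (Fin m)))
    [IsProbabilityMeasure μ] [IsProbabilityMeasure ν] :
    ∫ v : EuclideanSpace ℝ (Fin m), Complex.exp (-(1/4 : ℂ) * ‖v‖ ^ 2) *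
      (charFun μ v * charFun ν (-v))
    = ((π / (1/4 : ℂ)) ^ ((m : ℂ) / 2)) *
      ((∫ x, ∫ y, Real.exp (-‖x - y‖ ^ 2) ∂ν ∂μ : ℝ) : ℂ) := by
  have h1 : ∀ v : EuclideanSpace ℝ (Fin m), Complex.exp (-(1/4 : ℂ) * ‖v‖ ^ 2) *
      (charFun μ v * charFun ν (-v)) = ∫ p, Complex.exp (-(1/4 : ℂ) * ‖v‖ ^ 2) *
        Complex.exp ((inner ℝ (p.1 - p.2) v : ℝ) * Complex.I) ∂(μ.prod ν) := by
    intro v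
    rw [integral_const_mul, charFun_apply, charFun_apply, ← integral_prod_mul]
    congr 2
    ext p
    rw [← Complex.exp_add]
    congr 1
    rw [inner_sub_left, inner_neg_right]
    push_cast
    ring
  simp_rw [h1]
  rw [integral_integral_swap]
  · have h2 : ∀ p : EuclideanSpace ℝ (Fin m) × EuclideanSpace ℝ (Fin m),
        ∫ v : EuclideanSpace ℝ (Fin m), Complex.exp (-(1/4 : ℂ) * ‖v‖ ^ 2) *
        Complex.exp ((inner ℝ (p.1 - p.2) v : ℝ) * Complex.I)
        = ((π / (1/4 : ℂ)) ^ ((m : ℂ) / 2)) * ((Real.exp (-‖p.1 - p.2‖ ^ 2) : ℝ) : ℂ) := by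
      intro p
      have := GaussianFourier.integral_cexp_neg_mul_sq_norm_add
        (V := EuclideanSpace ℝ (Fin m)) (b := 1/4) (by norm_num) Complex.I (p.1 - p.2)
      rw [finrank_euclideanSpace_fin] at this
      convert! this using 2
      · ext v
        rw [← Complex.exp_add, mul_comm Complex.I]
      · push_cast
        rw [Complex.I_sq]
        congr 1
        ring
    simp_rw [h2]
    rw [integral_const_mul, integral_complex_ofReal, integral_prod _ (ker_integrable _)]
  · refine ((gk_integrable (m := m)).comp_fst (μ.prod ν)).mono
      (Continuous.aestronglyMeasurable (by simp only [Function.uncurry_def]; fun_prop)) ?_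
    filter_upwards with p
    simp only [Function.uncurry_def]
    rw [norm_mul, Complex.norm_exp_ofReal_mul_I, mul_one]

lemma key_integrable {m : ℕ} (μ ν : Measure (EuclideanSpace ℝ (Fin m)))
    [IsProbabilityMeasure μ] [IsProbabilityMeasure ν] :
    Integrable (fun v : EuclideanSpace ℝ (Fin m) => Complex.exp (-(1/4 : ℂ) * ‖v‖ ^ 2) *
      (charFun μ v * charFun ν (-v))) := by
  have hc : Continuous (charFun μ) := continuous_charFun
  have hc' : Continuous (charFun ν) := continuous_charFun
  refine (gk_integrable (m := m)).mono (Continuous.aestronglyMeasurable (by fun_prop)) ?_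
  filter_upwards with v
  rw [norm_mul, norm_mul]
  have a := norm_charFun_le_one (μ := μ) v
  have b := norm_charFun_le_one (μ := ν) (-v)
  exact mul_le_of_le_one_right (norm_nonneg _) (mul_le_one₀ a (norm_nonneg _) b)

/-- The Gaussian kernel `k(x,y) = exp(-‖x-y‖²)` on `ℝ^m` is characteristic: if the
Gaussian-kernel squared MMD between Borel probability measures `P` and `Q` vanishes,
then `P = Q`. -/
theorem gaussian_mmd_eq_zero_imp_eq {m : ℕ}
    (P Q : Measure (EuclideanSpace ℝ (Fin m)))
    [IsProbabilityMeasure P] [IsProbabilityMeasure Q]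
    (h : (∫ x, ∫ x', Real.exp (-‖x - x'‖ ^ 2) ∂P ∂P)
        - 2 * (∫ x, ∫ y, Real.exp (-‖x - y‖ ^ 2) ∂Q ∂P)
        + (∫ y, ∫ y', Real.exp (-‖y - y'‖ ^ 2) ∂Q ∂Q) = 0) :
    P = Q := by
  have hP : Continuous (charFun P) := continuous_charFun
  have hQ : Continuous (charFun Q) := continuous_charFun
  have hsymm : (∫ y, ∫ x, Real.exp (-‖y - x‖ ^ 2) ∂P ∂Q)
      = ∫ x, ∫ y, Real.exp (-‖x - y‖ ^ 2) ∂Q ∂P := by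
    rw [integral_integral_swap (ker_integrable (Q.prod P))]
    simp_rw [norm_sub_rev]
  have hpt : ∀ v : EuclideanSpace ℝ (Fin m),
      ((Real.exp (-(1/4) * ‖v‖ ^ 2) * ‖charFun P v - charFun Q v‖ ^ 2 : ℝ) : ℂ)
      = Complex.exp (-(1/4 : ℂ) * ‖v‖ ^ 2) * (charFun P v * charFun P (-v))
        - Complex.exp (-(1/4 : ℂ) * ‖v‖ ^ 2) * (charFun P v * charFun Q (-v))
        - Complex.exp (-(1/4 : ℂ) * ‖v‖ ^ 2) * (charFun Q v * charFun P (-v))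
        + Complex.exp (-(1/4 : ℂ) * ‖v‖ ^ 2) * (charFun Q v * charFun Q (-v)) := by
    intro v
    push_cast
    rw [← Complex.mul_conj', map_sub, charFun_neg, charFun_neg]
    ring
  have i1 := (key_integrable P P).sub (key_integrable P Q)
  have i2 := i1.sub (key_integrable Q P)
  have i3 := i2.add (key_integrable Q Q)
  have hint : Integrable (fun v : EuclideanSpace ℝ (Fin m) =>
      Real.exp (-(1/4) * ‖v‖ ^ 2) * ‖charFun P v - charFun Q v‖ ^ 2) := by
    have : Integrable (fun v : EuclideanSpace ℝ (Fin m) =>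
      ((Real.exp (-(1/4) * ‖v‖ ^ 2) * ‖charFun P v - charFun Q v‖ ^ 2 : ℝ) : ℂ)) := by
      simp_rw [hpt]; exact i3
    simpa only [RCLike.re_to_complex, Complex.ofReal_re] using this.re
  have hzero : ∫ v : EuclideanSpace ℝ (Fin m),
      Real.exp (-(1/4) * ‖v‖ ^ 2) * ‖charFun P v - charFun Q v‖ ^ 2 = 0 := by
    apply Complex.ofReal_injective
    rw [← integral_complex_ofReal]
    simp_rw [hpt]
    simp only [Pi.sub_def] at i1 i2
    rw [integral_add i2 (key_integrable Q Q), integral_sub i1 (key_integrable Q P),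
      integral_sub (key_integrable P P) (key_integrable P Q), key, key, key, key, hsymm]
    rw [← mul_sub, ← mul_sub, ← mul_add]
    have := congrArg (fun r : ℝ => (r : ℂ)) h
    push_cast at this ⊢
    rw [mul_eq_zero]
    right
    linear_combination this
  rw [integral_eq_zero_iff_of_nonneg (fun v => by positivity) hint] at hzero
  rw [Continuous.ae_eq_iff_eq _ (by fun_prop) (by exact continuous_const)] at hzero
  apply Measure.ext_of_charFun
  ext v
  have := congrFun hzero v
  simpa [Real.exp_ne_zero, sub_eq_zero] using this
end

section
/- Let f : ℝ^d → ℝ^m be a continuous injective map, and let P and Q be Borel probability measures on ℝ^d. If M_f(P,Q) = 0, then P = Q. -/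
open MeasureTheory Real

section Aux

variable {m : ℕ}

local notation "E" => EuclideanSpace ℝ (Fin m)

noncomputable def gw (m : ℕ) : Measure (EuclideanSpace ℝ (Fin m)) :=
  volume.withDensity (fun v => ENNReal.ofReal (Real.exp (-(1/4) * ‖v‖ ^ 2)))

lemma gw_integrable : Integrable (fun v : E => Real.exp (-(1/4) * ‖v‖ ^ 2)) := by
  have h := (GaussianFourier.integrable_cexp_neg_mul_sq_norm_add (V := E) (b := 1/4)
    (by norm_num) 0 0).re
  refine h.congr (Filter.Eventually.of_forall fun v => ?_)
  have : (-(1/4 : ℂ) * (‖v‖ : ℂ) ^ 2 + 0 * ((inner ℝ (0 : E) v : ℝ) : ℂ))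
      = ((-(1/4) * ‖v‖ ^ 2 : ℝ) : ℂ) := by
    push_cast; ring
  simp only [this]
  rw [← Complex.ofReal_exp]
  exact Complex.ofReal_re _

instance : IsFiniteMeasure (gw m) := by
  unfold gw
  exact isFiniteMeasure_withDensity_ofReal gw_integrable.2

lemma gw_ac : (volume : Measure E) ≪ gw m := by
  unfold gw
  apply withDensity_absolutelyContinuous'
  · fun_prop
  · exact Filter.Eventually.of_forall fun v => by simp [Real.exp_pos]

lemma gw_charFun (t : E) :
    charFun (gw m) t = (((4 * π) ^ ((m : ℝ) / 2) * Real.exp (-‖t‖ ^ 2) : ℝ) : ℂ) := by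
  rw [charFun_apply, gw, integral_withDensity_eq_integral_toReal_smul₀ (by fun_prop) (by simp)]
  have h := GaussianFourier.integral_cexp_neg_mul_sq_norm_add (V := E) (b := 1/4)
    (by norm_num) Complex.I t
  rw [Complex.ofReal_mul, Complex.ofReal_cpow (by positivity)]
  convert h using 1
  · congr 1
    ext v
    rw [ENNReal.toReal_ofReal (Real.exp_pos _).le, Complex.real_smul, Complex.ofReal_exp,
      ← Complex.exp_add, real_inner_comm]
    congr 1
    push_cast; ring
  · simp only [Complex.I_sq, finrank_euclideanSpace, Fintype.card_fin]
    push_cast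
    congr 2 <;> ring_nf

lemma fub (γ μ ν : Measure E) [IsFiniteMeasure γ] [IsFiniteMeasure μ] [IsFiniteMeasure ν] :
    ∫ x, ∫ y, charFun γ (x - y) ∂ν ∂μ
      = ∫ t, charFun μ t * (starRingEnd ℂ) (charFun ν t) ∂γ := by
  have hb : ∀ z : ℝ, ‖Complex.exp (z * Complex.I)‖ ≤ 1 := fun z =>
    (Complex.norm_exp_ofReal_mul_I z).le
  have e1 : ∀ x, ∫ y, charFun γ (x - y) ∂ν
      = ∫ t, Complex.exp (inner ℝ x t * Complex.I) * charFun ν (-t) ∂γ := by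
    intro x
    simp_rw [charFun_apply]
    rw [integral_integral_swap]
    · congr 1; ext t
      rw [← integral_const_mul]
      congr 1; ext y
      rw [← Complex.exp_add, inner_sub_right, inner_neg_right, real_inner_comm x t,
        real_inner_comm y t]
      congr 1
      push_cast; ring
    · refine Integrable.of_bound (C := 1) ?_ (Filter.Eventually.of_forall fun p => hb _)
      refine Continuous.aestronglyMeasurable ?_
      simp only [Function.uncurry_def]
      fun_prop
  simp_rw [e1]
  rw [integral_integral_swap]
  · congr 1; ext t
    rw [integral_mul_const, charFun_neg, charFun_apply (μ := μ)]
  · refine Integrable.of_bound (C := ν.real Set.univ) ?_ (Filter.Eventually.of_forall fun p => ?_)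
    · simp only [Function.uncurry_def]
      refine AEStronglyMeasurable.mul (Continuous.aestronglyMeasurable (by fun_prop)) ?_
      exact ((stronglyMeasurable_charFun (μ := ν)).comp_measurable
        (g := fun p : E × E => -p.2) (by fun_prop)).aestronglyMeasurable
    · simp only [Function.uncurry_def]
      rw [norm_mul, Complex.norm_exp_ofReal_mul_I, one_mul]
      exact norm_charFun_le _

lemma fub' (μ ν : Measure E) [IsFiniteMeasure μ] [IsFiniteMeasure ν] :
    (((4 * π) ^ ((m : ℝ) / 2) * ∫ x, ∫ y, Real.exp (-‖x - y‖ ^ 2) ∂ν ∂μ : ℝ) : ℂ)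
      = ∫ t, charFun μ t * (starRingEnd ℂ) (charFun ν t) ∂(gw m) := by
  rw [← fub]
  simp_rw [gw_charFun, integral_complex_ofReal, integral_const_mul]

lemma gauss_char (μ ν : Measure E) [IsFiniteMeasure μ] [IsFiniteMeasure ν]
    (h : (∫ x, ∫ x', Real.exp (-‖x - x'‖ ^ 2) ∂μ ∂μ)
    - 2 * (∫ x, ∫ y, Real.exp (-‖x - y‖ ^ 2) ∂ν ∂μ)
    + (∫ y, ∫ y', Real.exp (-‖y - y'‖ ^ 2) ∂ν ∂ν) = 0) : μ = ν := by
  have hint : ∀ (μ ν : Measure E) [IsFiniteMeasure μ] [IsFiniteMeasure ν],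
      Integrable (fun t => charFun μ t * (starRingEnd ℂ) (charFun ν t)) (gw m) := by
    intro μ ν _ _
    refine Integrable.of_bound (C := μ.real Set.univ * ν.real Set.univ) ?_
      (Filter.Eventually.of_forall fun t => ?_)
    · exact (stronglyMeasurable_charFun.mul
        (Complex.continuous_conj.comp_stronglyMeasurable
          stronglyMeasurable_charFun)).aestronglyMeasurable
    · rw [norm_mul, RCLike.norm_conj]
      gcongr <;> exact norm_charFun_le _
  have hr : ∀ (μ ν : Measure E) [IsFiniteMeasure μ] [IsFiniteMeasure ν],
      (4 * π) ^ ((m : ℝ) / 2) * ∫ x, ∫ y, Real.exp (-‖x - y‖ ^ 2) ∂ν ∂μ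
      = ∫ t, (charFun μ t * (starRingEnd ℂ) (charFun ν t)).re ∂(gw m) := by
    intro μ ν _ _
    have := congrArg Complex.re (fub' μ ν)
    rw [Complex.ofReal_re] at this
    rw [this]
    exact (integral_re (hint μ ν)).symm
  have key : ∫ t, Complex.normSq (charFun μ t - charFun ν t) ∂(gw m) = 0 := by
    have e : ∀ t, Complex.normSq (charFun μ t - charFun ν t)
        = (charFun μ t * (starRingEnd ℂ) (charFun μ t)).re
          - 2 * (charFun μ t * (starRingEnd ℂ) (charFun ν t)).re
          + (charFun ν t * (starRingEnd ℂ) (charFun ν t)).re := by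
      intro t
      simp [Complex.normSq_apply]; ring
    simp_rw [e]
    have hre : ∀ (μ ν : Measure E) [IsFiniteMeasure μ] [IsFiniteMeasure ν],
        Integrable (fun t => (charFun μ t * (starRingEnd ℂ) (charFun ν t)).re) (gw m) :=
      fun μ ν _ _ => (hint μ ν).re
    have hsub : Integrable (fun t => (charFun μ t * (starRingEnd ℂ) (charFun μ t)).re
        - 2 * (charFun μ t * (starRingEnd ℂ) (charFun ν t)).re) (gw m) :=
      (hre μ μ).sub ((hre μ ν).const_mul 2)
    rw [integral_add hsub (hre ν ν),
      integral_sub (hre μ μ) ((hre μ ν).const_mul 2), integral_const_mul,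
      ← hr, ← hr, ← hr]
    linear_combination (4 * π) ^ ((m : ℝ) / 2) * h
  rw [integral_eq_zero_iff_of_nonneg (fun t => Complex.normSq_nonneg _)] at key
  · have h2 : charFun μ =ᵐ[volume] charFun ν := by
      filter_upwards [gw_ac.ae_le key] with t ht
      exact sub_eq_zero.1 (Complex.normSq_eq_zero.1 ht)
    refine Measure.ext_of_charFun ?_
    exact Continuous.ae_eq_iff_eq volume continuous_charFun continuous_charFun |>.1 h2
  · have e : ∀ t, Complex.normSq (charFun μ t - charFun ν t)
        = (charFun μ t * (starRingEnd ℂ) (charFun μ t)).re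
          - 2 * (charFun μ t * (starRingEnd ℂ) (charFun ν t)).re
          + (charFun ν t * (starRingEnd ℂ) (charFun ν t)).re := by
      intro t
      simp [Complex.normSq_apply]; ring
    simp_rw [e]
    exact ((hint μ μ).re.sub ((hint μ ν).re.const_mul 2)).add (hint ν ν).re

end Aux

/-- Composing the (characteristic) Gaussian kernel with a continuous injective map `f`
yields a characteristic kernel: if `M_f(P,Q) = 0` then `P = Q`. -/
theorem sqMMD_eq_zero_imp_eq_of_injective {d m : ℕ}
    (f : EuclideanSpace ℝ (Fin d) → EuclideanSpace ℝ (Fin m))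
    (hf_cont : Continuous f) (hf_inj : Function.Injective f)
    (P Q : Measure (EuclideanSpace ℝ (Fin d)))
    [IsProbabilityMeasure P] [IsProbabilityMeasure Q]
    (h : sqMMD f P Q = 0) : P = Q := by
  have hme : MeasurableEmbedding f := hf_cont.measurableEmbedding hf_inj
  have hmap : P.map f = Q.map f := by
    apply gauss_char
    simp_rw [hme.integral_map]
    exact h
  rw [← hme.comap_map P, hmap, hme.comap_map]
end
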